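/- Let p be a prime, s ∈ ℝ, γ ∈ ℕ, c ∈ ℤ_p, and let B = closedBall(c, p^{-γ}) ⊆ ℤ_p. Let f : ℚ_p → ℂ be a wavelet-type function on B, i.e. f vanishes outside B, f is constant on every closed ball of radius p^{-γ-1} contained in B, and ∫_{ℤ_p} f dvol = 0. Then f is an eigenfunction of the Vladimirov–Taibleson-type operator Δ^s on ℤ_p: for every x ∈ B, ∫_{ℤ_p} |x − y|_p^{-s} (f(x) − f(y)) dvol(y) = λ · f(x), where λ = ∫_{ℤ_p \ B} |c − y|_p^{-s} dvol(y) + (p^{-γ})^{1−s}; moreover λ is independent of the choice of x ∈ B, since |x − y|_p = |c − y|_p for all x ∈ B and y ∈ ℤ_p \ B. -/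

import Mathlib

open Set MeasureTheory

namespace Padic

variable {p : ℕ} [Fact p.Prime]

/-- The unit ball of `ℚ_[p]` is the union of the balls of radius `p ^ (-n)` around
`0, 1, …, p ^ n - 1`. -/
theorem closedBall_zero_one_eq_iUnion (n : ℕ) :
    Metric.closedBall (0 : ℚ_[p]) 1 =
      ⋃ i ∈ Finset.range (p ^ n), Metric.closedBall (i : ℚ_[p]) ((p : ℝ) ^ (-(n : ℤ))) := by
  ext x
  simp only [mem_iUnion, Metric.mem_closedBall, dist_zero_right, Finset.mem_range, exists_prop]
  constructor
  · intro hx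
    obtain ⟨z, rfl⟩ : ∃ z : ℤ_[p], (z : ℚ_[p]) = x := ⟨⟨x, hx⟩, rfl⟩
    refine ⟨z.appr n, PadicInt.appr_lt _ _, ?_⟩
    have h := (PadicInt.norm_le_pow_iff_mem_span_pow _ n).mpr (PadicInt.appr_spec n z)
    rw [PadicInt.norm_def, PadicInt.coe_sub, PadicInt.coe_natCast] at h
    rwa [dist_eq_norm]
  · rintro ⟨i, -, hi⟩
    have hp : (1 : ℝ) ≤ p := by exact_mod_cast (Fact.out : p.Prime).one_le
    have hr : (p : ℝ) ^ (-(n : ℤ)) ≤ 1 := zpow_le_one_of_nonpos₀ hp (by simp)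
    have hi1 : ‖(i : ℚ_[p])‖ ≤ 1 := by simpa using Padic.norm_int_le_one (p := p) (i : ℤ)
    calc ‖x‖ = ‖(x - i) + i‖ := by rw [sub_add_cancel]
      _ ≤ max ‖x - i‖ ‖(i : ℚ_[p])‖ := Padic.nonarchimedean _ _
      _ ≤ 1 := max_le ((dist_eq_norm x (i : ℚ_[p]) ▸ hi).trans hr) hi1

theorem pairwiseDisjoint_closedBall_natCast (n : ℕ) :
    (Finset.range (p ^ n) : Set ℕ).PairwiseDisjoint
      fun i ↦ Metric.closedBall (i : ℚ_[p]) ((p : ℝ) ^ (-(n : ℤ))) := by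
  intro i hi j hj hij
  refine Set.disjoint_left.mpr fun x hxi hxj ↦ hij ?_
  rw [Metric.mem_closedBall] at hxi hxj
  have h : ‖(((i : ℤ) - (j : ℤ) : ℤ) : ℚ_[p])‖ ≤ (p : ℝ) ^ (-(n : ℤ)) := by
    have h := (dist_triangle_max (i : ℚ_[p]) x (j : ℚ_[p])).trans
      (max_le (by rwa [dist_comm]) hxj)
    simpa [dist_eq_norm] using h
  rw [Padic.norm_int_le_pow_iff_dvd] at h
  have hi' : i < p ^ n := by simpa using hi
  have hj' : j < p ^ n := by simpa using hj
  have hmod : j ≡ i [MOD p ^ n] := (Nat.modEq_iff_dvd).mpr (by exact_mod_cast h)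
  exact (hmod.eq_of_lt_of_lt hj' hi').symm

variable [MeasurableSpace ℚ_[p]] [BorelSpace ℚ_[p]]

/-- The Haar measure of a ball of radius `p ^ (-n)`, normalized by `μ ℤ_p = 1`. -/
theorem measureReal_closedBall (μ : Measure ℚ_[p]) [μ.IsAddHaarMeasure]
    (hμ : μ (Metric.closedBall (0 : ℚ_[p]) 1) = 1) (c : ℚ_[p]) (n : ℕ) :
    μ.real (Metric.closedBall c ((p : ℝ) ^ (-(n : ℤ)))) = (p : ℝ) ^ (-(n : ℤ)) := by
  have hball (a : ℚ_[p]) (r : ℝ) :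
      μ.real (Metric.closedBall a r) = μ.real (Metric.closedBall (0 : ℚ_[p]) r) := by
    rw [Measure.real, Measure.addHaar_closedBall_center, Measure.real]
  have h1 : μ.real (Metric.closedBall (0 : ℚ_[p]) 1) = 1 := by simp [Measure.real, hμ]
  rw [closedBall_zero_one_eq_iUnion n,
    measureReal_biUnion_finset (pairwiseDisjoint_closedBall_natCast n)
      (fun _ _ ↦ Metric.isClosed_closedBall.measurableSet)
      (fun _ _ ↦ (isCompact_closedBall _ _).measure_lt_top.ne)] at h1
  simp only [hball (Nat.cast _), Finset.sum_const, Finset.card_range, nsmul_eq_mul,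
    Nat.cast_pow] at h1
  rw [hball, zpow_neg, zpow_natCast]
  rw [zpow_neg, zpow_natCast] at h1
  exact eq_inv_of_mul_eq_one_right h1

end Padic

/-- A wavelet-type function `f` supported on a ball
`B = closedBall(c, p^{-γ}) ⊆ ℤ_p` (i.e. `f` vanishes outside `B`, is constant on every
closed ball of radius `p^{-γ-1}` contained in `B`, and has mean zero over `ℤ_p`) is an
eigenfunction of the Vladimirov–Taibleson-type operator `Δ^s` on `ℤ_p`, with eigenvalue
`λ = ∫_{ℤ_p \ B} |c − y|^{-s} dvol(y) + (p^{-γ})^{1−s}`; moreover `|x − y| = |c − y|`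
for all `x ∈ B`, `y ∈ ℤ_p \ B`, so `λ` does not depend on the choice of `x ∈ B`. -/
theorem wavelet_eigenfunction (p : ℕ) [Fact p.Prime]
    [MeasurableSpace ℚ_[p]] [BorelSpace ℚ_[p]]
    (μ : Measure ℚ_[p]) [μ.IsAddHaarMeasure]
    (hμ : μ (Metric.closedBall (0 : ℚ_[p]) 1) = 1)
    (s : ℝ) (γ : ℕ) (c : ℚ_[p]) (hc : c ∈ Metric.closedBall (0 : ℚ_[p]) 1)
    (f : ℚ_[p] → ℂ)
    (hsupp : ∀ x ∉ Metric.closedBall c ((p : ℝ) ^ (-(γ : ℤ))), f x = 0)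
    (hconst : ∀ a : ℚ_[p],
      Metric.closedBall a ((p : ℝ) ^ (-(γ : ℤ) - 1)) ⊆
          Metric.closedBall c ((p : ℝ) ^ (-(γ : ℤ))) →
        ∀ x ∈ Metric.closedBall a ((p : ℝ) ^ (-(γ : ℤ) - 1)),
          ∀ y ∈ Metric.closedBall a ((p : ℝ) ^ (-(γ : ℤ) - 1)), f x = f y)
    (hmean : ∫ x in Metric.closedBall (0 : ℚ_[p]) 1, f x ∂μ = 0) :
    (∀ x ∈ Metric.closedBall c ((p : ℝ) ^ (-(γ : ℤ))),
      ∀ y ∈ Metric.closedBall (0 : ℚ_[p]) 1 \ Metric.closedBall c ((p : ℝ) ^ (-(γ : ℤ))),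
        ‖x - y‖ = ‖c - y‖) ∧
    ∀ x ∈ Metric.closedBall c ((p : ℝ) ^ (-(γ : ℤ))),
      ∫ y in Metric.closedBall (0 : ℚ_[p]) 1,
          (↑(‖x - y‖ ^ (-s)) : ℂ) * (f x - f y) ∂μ =
        (↑((∫ y in Metric.closedBall (0 : ℚ_[p]) 1 \
              Metric.closedBall c ((p : ℝ) ^ (-(γ : ℤ))), ‖c - y‖ ^ (-s) ∂μ) +
            ((p : ℝ) ^ (-(γ : ℤ))) ^ (1 - s)) : ℂ) * f x := by
  have hp0 : (0 : ℝ) < p := by exact_mod_cast (Fact.out : p.Prime).pos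
  have hp1 : (1 : ℝ) < p := by exact_mod_cast (Fact.out : p.Prime).one_lt
  set r : ℝ := (p : ℝ) ^ (-(γ : ℤ)) with hr
  set ρ : ℝ := (p : ℝ) ^ (-(γ : ℤ) - 1)
  have hr0 : 0 < r := zpow_pos hp0 _
  have hρ0 : 0 < ρ := zpow_pos hp0 _
  have hρr : ρ ≤ r := zpow_le_zpow_right₀ hp1.le (by lia)
  have hr1 : r ≤ 1 := zpow_le_one_of_nonpos₀ hp1.le (by simp)
  set Z := Metric.closedBall (0 : ℚ_[p]) 1
  set B := Metric.closedBall c r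
  have hBZ : B ⊆ Z := by
    rw [show Z = Metric.closedBall c 1 from IsUltrametricDist.closedBall_eq_of_mem hc]
    exact Metric.closedBall_subset_closedBall hr1
  have hB : MeasurableSet B := Metric.isClosed_closedBall.measurableSet
  have hZBc : IsCompact (Z \ B) :=
    (isCompact_closedBall _ _).diff (IsUltrametricDist.isOpen_closedBall c hr0.ne')
  have hdist : ∀ x ∈ B, ∀ y ∈ Z \ B, ‖x - y‖ = ‖c - y‖ := by
    rintro x hx y ⟨-, hy⟩
    have hxc : ‖x - c‖ ≤ r := by simpa [B, dist_eq_norm] using hx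
    have hcy : r < ‖c - y‖ := by simpa [B, dist_eq_norm, norm_sub_rev] using hy
    rw [← sub_add_sub_cancel x c y,
      IsUltrametricDist.norm_add_eq_max_of_norm_ne_norm (hxc.trans_lt hcy).ne,
      max_eq_right (hxc.trans hcy.le)]
  -- `f` is constant on balls of radius `ρ`, inside or outside `B`
  have hlc : ∀ x y, dist y x ≤ ρ → f y = f x := by
    intro x y hxy
    by_cases hx : x ∈ B
    · refine hconst x ?_ y hxy x (Metric.mem_closedBall_self hρ0.le)
      rw [show B = Metric.closedBall x r from IsUltrametricDist.closedBall_eq_of_mem hx]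
      exact Metric.closedBall_subset_closedBall hρr
    · have hy : y ∉ B := fun hy ↦ hx <| by
        rw [show B = Metric.closedBall y r from IsUltrametricDist.closedBall_eq_of_mem hy,
          Metric.mem_closedBall']
        exact hxy.trans hρr
      rw [hsupp x hx, hsupp y hy]
  have hfc : Continuous f := by
    refine continuous_iff_continuousAt.mpr fun x ↦ ?_
    refine (continuousAt_const (y := f x)).congr ?_
    filter_upwards [Metric.closedBall_mem_nhds x hρ0] with y hy using (hlc x y hy).symm
  have hfB : ∫ y in B, f y ∂μ = 0 := by
    rw [← hmean]
    exact (setIntegral_eq_of_subset_of_forall_sdiff_eq_zero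
      Metric.isClosed_closedBall.measurableSet hBZ fun y hy ↦ hsupp y hy.2).symm
  refine ⟨hdist, fun x hx ↦ ?_⟩
  have hinB : EqOn (fun y ↦ (↑(‖x - y‖ ^ (-s)) : ℂ) * (f x - f y))
      (fun y ↦ (↑(r ^ (-s)) : ℂ) * (f x - f y)) B := by
    intro y hy
    by_cases hxy : ‖x - y‖ ≤ ρ
    · simp [hlc y x (by rwa [dist_eq_norm])]
    · have hle : ‖x - y‖ ≤ r := by
        rw [← dist_eq_norm]
        exact (dist_triangle_max x c y).trans (max_le hx (Metric.mem_closedBall'.mp hy))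
      have heq : ‖x - y‖ = r := by
        refine hle.antisymm (not_lt.mp fun hlt ↦ hxy ?_)
        rwa [hr, Padic.norm_lt_pow_iff_norm_le_pow_sub_one] at hlt
      simp only [heq]
  have houtB : EqOn (fun y ↦ (↑(‖x - y‖ ^ (-s)) : ℂ) * (f x - f y))
      (fun y ↦ (↑(‖c - y‖ ^ (-s)) : ℂ) * f x) (Z \ B) := by
    intro y hy
    simp only [hdist x hx y hy, hsupp y hy.2, sub_zero]
  have hint : IntegrableOn (fun y ↦ (↑(r ^ (-s)) : ℂ) * (f x - f y)) B μ :=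
    (by fun_prop : Continuous fun y ↦ (↑(r ^ (-s)) : ℂ) * (f x - f y)).continuousOn
      |>.integrableOn_compact (isCompact_closedBall _ _)
  have hintout : IntegrableOn (fun y ↦ (↑(‖c - y‖ ^ (-s)) : ℂ) * f x) (Z \ B) μ := by
    refine ContinuousOn.integrableOn_compact hZBc ?_
    refine ContinuousOn.mul (Complex.continuous_ofReal.comp_continuousOn ?_) continuousOn_const
    refine (by fun_prop : Continuous fun y ↦ ‖c - y‖).continuousOn.rpow_const fun y hy ↦ Or.inl ?_
    rw [norm_ne_zero_iff, sub_ne_zero]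
    rintro rfl
    exact hy.2 (Metric.mem_closedBall_self hr0.le)
  have hZBm : MeasurableSet (Z \ B) := Metric.isClosed_closedBall.measurableSet.diff hB
  have hvalB : ∫ y in B, (↑(r ^ (-s)) : ℂ) * (f x - f y) ∂μ = (↑(r ^ (1 - s)) : ℂ) * f x := by
    have hfi : IntegrableOn f B μ :=
      hfc.continuousOn.integrableOn_compact (isCompact_closedBall _ _)
    have hci : IntegrableOn (fun _ ↦ f x) B μ :=
      continuousOn_const.integrableOn_compact (isCompact_closedBall _ _)
    rw [integral_const_mul, integral_sub hci hfi, hfB, setIntegral_const,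
      Padic.measureReal_closedBall μ hμ c γ, ← hr, sub_zero, sub_eq_add_neg,
      Real.rpow_add hr0, Real.rpow_one, Complex.real_smul]
    push_cast
    ring
  rw [← sdiff_union_of_subset hBZ, setIntegral_union disjoint_sdiff_left hB
      (hintout.congr_fun houtB.symm hZBm) (hint.congr_fun hinB.symm hB),
    setIntegral_congr_fun hZBm houtB, setIntegral_congr_fun hB hinB, hvalB, integral_mul_const,
    integral_complex_ofReal, sdiff_union_of_subset hBZ, Complex.ofReal_add, add_mul]
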